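/- There exists a constant C > 0 such that for every n ≥ 1 and k ≥ 2, setting ε = ε(n,k) and δ = δ(n,k) with ε, δ ≤ C·k·n^{-1/3} and δ ∈ (0,1), every n-player k-action anonymous game admits an ε-Nash equilibrium in δ-perturbed pure strategies. -/

import Mathlib

open Finset

/-- `perturbW k δ a j` is the probability that the `δ`-perturbation of the pure
action `a ∈ [k]` plays the action `j`: with probability `1-δ` play `a`, with
probability `δ` play uniformly in `[k]`. -/
noncomputable def perturbW (k : ℕ) (δ : ℝ) (a j : Fin k) : ℝ :=
  (1 - δ) * (if j = a then 1 else 0) + δ / k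

/-- Probability that the (independent) `δ`-perturbation of the pure profile `a`
realises as the pure profile `b`. -/
noncomputable def profW (n k : ℕ) (δ : ℝ) (a b : Fin n → Fin k) : ℝ :=
  ∏ i, perturbW k δ (a i) (b i)

/-- A game: payoffs lie in `[0,1]`. -/
def IsGame (n k : ℕ) (g : (Fin n → Fin k) → Fin n → ℝ) : Prop :=
  ∀ a i, g a i ∈ Set.Icc (0 : ℝ) 1

/-- The number of players taking action `j` in the profile `a`. -/
def actCount (n k : ℕ) (a : Fin n → Fin k) (j : Fin k) : ℕ :=
  (Finset.univ.filter fun i => a i = j).card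

/-- A game is anonymous if each player's payoff depends only on his own action and
on the number of players taking each action. -/
def IsAnonymous (n k : ℕ) (g : (Fin n → Fin k) → Fin n → ℝ) : Prop :=
  ∀ (a b : Fin n → Fin k) (i : Fin n), a i = b i →
    (∀ j, actCount n k a j = actCount n k b j) → g a i = g b i

/-- The `δ`-perturbed game `g^δ`. -/
noncomputable def perturbGame (n k : ℕ) (δ : ℝ) (g : (Fin n → Fin k) → Fin n → ℝ) :
    (Fin n → Fin k) → Fin n → ℝ :=
  fun a i => ∑ b : Fin n → Fin k, profW n k δ a b * g b i

/-- The Lipschitz constant of a game: the largest change of some player's payoff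
when a single opponent changes his action. -/
noncomputable def lipC (n k : ℕ) (g : (Fin n → Fin k) → Fin n → ℝ) : ℝ :=
  sSup {x | ∃ (i : Fin n) (a b : Fin n → Fin k), a i = b i ∧
    (Finset.univ.filter fun j => a j ≠ b j).card = 1 ∧ x = |g a i - g b i|}

/-- The worst-case Lipschitz constant of `δ`-perturbed `n`-player `k`-action
anonymous games. -/
noncomputable def lam (n k : ℕ) (δ : ℝ) : ℝ :=
  sSup {x | ∃ g : (Fin n → Fin k) → Fin n → ℝ,
    IsGame n k g ∧ IsAnonymous n k g ∧ x = lipC n k (perturbGame n k δ g)}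
/-- `walk r m z` is the probability that the lazy symmetric random walk on `ℤ` with
rate `r` (i.i.d. increments: `0` w.p. `1-r`, `±1` w.p. `r/2` each), started at `0`,
is at `z` after `m` steps; i.e. `P(S_m^r = z)`. -/
noncomputable def walk (r : ℝ) : ℕ → ℤ → ℝ
  | 0, z => if z = 0 then 1 else 0
  | m + 1, z => (1 - r) * walk r m z + r / 2 * walk r m (z - 1) + r / 2 * walk r m (z + 1)
/-- A mixed strategy over `[k]`: a probability vector. -/
def IsMixed (k : ℕ) (τ : Fin k → ℝ) : Prop :=
  (∀ j, 0 ≤ τ j) ∧ ∑ j, τ j = 1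

/-- Expected payoff of player `i` in the game `g` when the players randomise
independently according to the mixed profile `σ`. -/
noncomputable def expPay (n k : ℕ) (g : (Fin n → Fin k) → Fin n → ℝ)
    (σ : Fin n → Fin k → ℝ) (i : Fin n) : ℝ :=
  ∑ b : Fin n → Fin k, (∏ i', σ i' (b i')) * g b i

/-- `σ` is an `ε`-Nash equilibrium of `g`: no player can gain more than `ε` by
unilaterally deviating to any mixed strategy. -/
def IsEpsNash (n k : ℕ) (ε : ℝ) (g : (Fin n → Fin k) → Fin n → ℝ)
    (σ : Fin n → Fin k → ℝ) : Prop :=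
  ∀ (i : Fin n) (τ : Fin k → ℝ), IsMixed k τ →
    expPay n k g (Function.update σ i τ) i - ε ≤ expPay n k g σ i
/-- A finite set `σ` is dominant for the family of rankings `r` if no element is ranked strictly
above the minimum of `σ` by all of them. -/
def Dominant {I T α : Type*} [LE α] (r : I → T → α) (σ : Finset T) : Prop :=
  ∀ y, ∃ i, ∀ x ∈ σ, r i y ≤ r i x

section Dominant

variable {I T α : Type*} [LinearOrder α] {r : I → T → α}

theorem Dominant.mono {σ τ : Finset T} (h : Dominant r σ) (hτ : τ ⊆ σ) : Dominant r τ := by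
  intro y
  obtain ⟨i, hi⟩ := h y
  exact ⟨i, fun x hx => hi x (hτ hx)⟩

open Classical in
/-- A dominant set with one element fewer than there are rankings has exactly two dominant
one-point extensions, unless dropping some ranking leaves it dominant. -/
theorem card_dominant_insert_eq_two [Fintype I] [Fintype T] [DecidableEq T]
    (hr : ∀ i, Function.Injective (r i)) {τ : Finset T} (hτ : Dominant r τ) (hne : τ.Nonempty)
    (hcard : τ.card + 1 = Fintype.card I)
    (hM : ∀ l, ∃ y, ∀ i, i ≠ l → ∃ x ∈ τ, r i x < r i y) :
    (univ.filter fun x => x ∉ τ ∧ Dominant r (insert x τ)).card = 2 := by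
  choose m hmτ hmin using fun i => τ.exists_min_image (r i) hne
  have hsurj : ∀ x ∈ τ, ∃ i, m i = x := by
    intro x hx
    obtain ⟨i, hi⟩ := hτ x
    exact ⟨i, hr i (le_antisymm (hmin i x hx) (hi _ (hmτ i)))⟩
  obtain ⟨p, q, hpq, hmpq⟩ : ∃ p q, p ≠ q ∧ m p = m q := by
    obtain ⟨p, -, q, -, h⟩ := Finset.exists_ne_map_eq_of_card_lt_of_maps_to
      (s := (univ : Finset I)) (t := τ) (by simp; omega) (f := m) (fun i _ => hmτ i)
    exact ⟨p, q, h⟩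
  have hinj : ∀ l l', p ≠ l → p ≠ l' → m l = m l' → l = l' := by
    intro l l' hl hl' h
    refine Finset.inj_on_of_surj_on_of_card_le (s := univ.erase p) (t := τ) (fun i _ => m i)
      (fun i _ => hmτ i) ?_ ?_ (by simpa using hl.symm) (by simpa using hl'.symm) h
    · intro x hx
      obtain ⟨i, rfl⟩ := hsurj x hx
      by_cases hi : i = p
      · exact ⟨q, by simpa using hpq.symm, by rw [hi, hmpq]⟩
      · exact ⟨i, by simpa using hi, rfl⟩
    · rw [Finset.card_erase_of_mem (mem_univ _), Finset.card_univ]; omega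
  let M : I → Finset T := fun l => univ.filter fun y => ∀ i, i ≠ l → r i (m i) < r i y
  have hMne : ∀ l, (M l).Nonempty := by
    intro l
    obtain ⟨y, hy⟩ := hM l
    refine ⟨y, Finset.mem_filter.2 ⟨mem_univ _, fun i hi => ?_⟩⟩
    obtain ⟨x, hx, hxy⟩ := hy i hi
    exact (hmin i x hx).trans_lt hxy
  choose w hwM hwmax using fun l => (M l).exists_max_image (r l) (hMne l)
  have hMmem : ∀ l y, y ∈ M l ↔ ∀ i, i ≠ l → r i (m i) < r i y := by simp [M]
  have hMdisj : ∀ y, y ∈ M p → y ∈ M q → False := by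
    intro y h1 h2
    obtain ⟨i, hi⟩ := hτ y
    by_cases h : i = p
    · exact absurd (hi _ (hmτ i)) (not_le.2 ((hMmem _ _).1 h2 i (h ▸ hpq)))
    · exact absurd (hi _ (hmτ i)) (not_le.2 ((hMmem _ _).1 h1 i h))
  have hMτ : ∀ l, l = p ∨ l = q → ∀ z ∈ τ, z ∉ M l := by
    intro l hl z hz hzM
    obtain ⟨i, rfl⟩ := hsurj z hz
    rw [hMmem] at hzM
    by_cases hil : i = l
    · subst hil
      rcases hl with rfl | rfl
      · exact absurd (hzM q hpq.symm) (by rw [hmpq]; exact lt_irrefl _)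
      · exact absurd (hzM p hpq) (by rw [hmpq]; exact lt_irrefl _)
    · exact lt_irrefl _ (hzM i hil)
  have hdom : ∀ l, Dominant r (insert (w l) τ) := by
    intro l y
    by_cases hy : y ∈ M l
    · obtain ⟨i, hi⟩ := hτ y
      have hil : i = l := by
        by_contra h
        exact absurd (hi _ (hmτ i)) (not_le.2 ((hMmem _ _).1 hy i h))
      subst hil
      refine ⟨i, fun x hx => ?_⟩
      rcases Finset.mem_insert.1 hx with rfl | hx
      · exact hwmax i y hy
      · exact hi x hx
    · rw [hMmem] at hy
      push Not at hy
      obtain ⟨i, hil, hi⟩ := hy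
      refine ⟨i, fun x hx => ?_⟩
      rcases Finset.mem_insert.1 hx with rfl | hx
      · exact hi.trans ((hMmem _ _).1 (hwM l) i hil).le
      · exact hi.trans (hmin i x hx)
  have hconv : ∀ x, x ∉ τ → Dominant r (insert x τ) → x = w p ∨ x = w q := by
    intro x hx hd
    choose κ hκ using hd
    have hκinj : ∀ a ∈ insert x τ, ∀ b ∈ insert x τ, κ a = κ b → a = b := by
      intro a ha b hb hab
      exact hr (κ a) (le_antisymm (hκ a b hb) (hab ▸ hκ b a ha))
    have hκsurj : ∀ i, ∃ z ∈ insert x τ, κ z = i := by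
      intro i
      obtain ⟨z, hz, h⟩ := Finset.surj_on_of_inj_on_of_card_le (s := insert x τ)
        (t := (univ : Finset I)) (fun z _ => κ z) (fun _ _ => mem_univ _)
        (fun a b ha hb => hκinj a ha b hb)
        (by rw [Finset.card_insert_of_notMem hx, Finset.card_univ]; omega) i (mem_univ _)
      exact ⟨z, hz, h.symm⟩
    have hz : ∀ i, i ≠ κ x → κ (m i) = i := by
      intro i hi
      obtain ⟨z, hz, rfl⟩ := hκsurj i
      have hzτ : z ∈ τ := by
        rcases Finset.mem_insert.1 hz with rfl | h
        · exact absurd rfl hi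
        · exact h
      have : m (κ z) = z := hr (κ z) (le_antisymm (hmin _ z hzτ)
        (hκ z _ (Finset.mem_insert_of_mem (hmτ _))))
      rw [this]
    have hxM : x ∈ M (κ x) := by
      rw [hMmem]
      intro i hi
      refine lt_of_le_of_ne ?_ fun h => hx (hr i h ▸ hmτ i)
      have := hκ (m i) x (Finset.mem_insert_self _ _)
      rwa [hz i hi] at this
    have hxmax : x = w (κ x) := by
      refine hr (κ x) (le_antisymm (hwmax _ x hxM) ?_)
      have hw := hκ (w (κ x))
      by_cases hi : κ (w (κ x)) = κ x
      · rw [hi] at hw; exact hw x (Finset.mem_insert_self _ _)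
      · exact absurd (hw _ (Finset.mem_insert_of_mem (hmτ _)))
          (not_le.2 ((hMmem _ _).1 (hwM (κ x)) _ hi))
    by_cases h1 : p = κ x
    · left; rw [h1]; exact hxmax
    · by_cases h2 : q = κ x
      · right; rw [h2]; exact hxmax
      · exact absurd ((hz p h1).symm.trans (hmpq ▸ hz q h2)) hpq
  have : (univ.filter fun x => x ∉ τ ∧ Dominant r (insert x τ)) = {w p, w q} := by
    ext x
    simp only [mem_filter, mem_univ, true_and, mem_insert, mem_singleton]
    constructor
    · rintro ⟨h1, h2⟩; exact hconv x h1 h2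
    · rintro (rfl | rfl)
      · exact ⟨fun h => hMτ p (Or.inl rfl) _ h (hwM p), hdom p⟩
      · exact ⟨fun h => hMτ q (Or.inr rfl) _ h (hwM q), hdom q⟩
  rw [this, Finset.card_pair]
  intro h
  exact hMdisj _ (hwM p) (h ▸ hwM q)

open Classical in
/-- **Scarf's lemma.** Each ranking `r i` puts the slack element `inr i` at the very bottom and
the other slack elements above `T`. Then some dominant set meets every colour exactly once. -/
theorem exists_dominant_image_eq_univ [Fintype I] [Fintype T] [Nonempty T]
    {r : I → T ⊕ I → α} (hr : ∀ i, Function.Injective (r i))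
    (hbot : ∀ i v, r i (Sum.inr i) < r i (Sum.inl v))
    (htop : ∀ i j v, j ≠ i → r i (Sum.inl v) < r i (Sum.inr j))
    (hI : 2 ≤ Fintype.card I) (c : T → I) :
    ∃ σ : Finset (T ⊕ I), Dominant r σ ∧ σ.image (Sum.elim c id) = univ := by
  set c' : T ⊕ I → I := Sum.elim c id with hc'
  have hbot' : ∀ i x, r i (Sum.inr i) ≤ r i x := by
    rintro i (v | j)
    · exact (hbot i v).le
    · by_cases h : j = i
      · rw [h]
      · obtain ⟨v⟩ := ‹Nonempty T›
        exact ((hbot i v).trans (htop i j v h)).le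
  by_contra! hno
  obtain ⟨i₀⟩ : Nonempty I := Fintype.card_pos_iff.1 (by omega)
  let D : Finset (Finset (T ⊕ I)) :=
    univ.filter fun τ => τ.card + 1 = Fintype.card I ∧ τ.image c' = univ.erase i₀
  let Q : Finset (Finset (T ⊕ I) × (T ⊕ I)) :=
    univ.filter fun p => p.1 ∈ D ∧ p.2 ∉ p.1 ∧ Dominant r (insert p.2 p.1)
  have hD : ∀ τ, τ ∈ D ↔ τ.card + 1 = Fintype.card I ∧ τ.image c' = univ.erase i₀ := by
    simp [D]
  have hQ : ∀ p, p ∈ Q ↔ p.1 ∈ D ∧ p.2 ∉ p.1 ∧ Dominant r (insert p.2 p.1) := by simp [Q]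
  have hDinj : ∀ τ ∈ D, Set.InjOn c' τ := by
    intro τ hτ
    rw [hD] at hτ
    apply Finset.card_image_iff.1
    rw [hτ.2, Finset.card_erase_of_mem (mem_univ _), Finset.card_univ]; omega
  have heven : Even Q.card := by
    rw [Finset.card_eq_sum_card_fiberwise (f := fun p => insert p.2 p.1) (t := univ)
      (fun _ _ => mem_coe.2 (mem_univ _))]
    refine Finset.even_sum _ fun σ _ => ?_
    by_cases hemp : (Q.filter fun p => insert p.2 p.1 = σ) = ∅
    · rw [hemp]; simp
    obtain ⟨⟨τ, x⟩, hτx⟩ := Finset.nonempty_iff_ne_empty.2 hemp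
    simp only [mem_filter, hQ] at hτx
    obtain ⟨⟨hτD, hxτ, hdom⟩, rfl⟩ := hτx
    have hτD' := (hD _).1 hτD
    have hcx : c' x ∈ τ.image c' := by
      rw [hτD'.2]
      refine Finset.mem_erase.2 ⟨fun h => hno _ hdom ?_, mem_univ _⟩
      rw [Finset.image_insert, hτD'.2, h, Finset.insert_erase (mem_univ _)]
    obtain ⟨x', hx', hcx'⟩ := Finset.mem_image.1 hcx
    have hxx' : x ≠ x' := fun h => hxτ (h ▸ hx')
    have himg : ((insert x τ).erase x').image c' = univ.erase i₀ := by
      rw [← hτD'.2]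
      ext a
      simp only [mem_image, mem_erase, mem_insert]
      constructor
      · rintro ⟨z, ⟨-, rfl | hz⟩, rfl⟩
        · exact ⟨x', hx', hcx'⟩
        · exact ⟨z, hz, rfl⟩
      · rintro ⟨z, hz, rfl⟩
        by_cases h : z = x'
        · exact ⟨x, ⟨hxx', Or.inl rfl⟩, by rw [h, hcx']⟩
        · exact ⟨z, ⟨h, Or.inr hz⟩, rfl⟩
    have hins : insert x' ((insert x τ).erase x') = insert x τ :=
      Finset.insert_erase (Finset.mem_insert_of_mem hx')
    have : (Q.filter fun p => insert p.2 p.1 = insert x τ) =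
        {(τ, x), ((insert x τ).erase x', x')} := by
      ext ⟨τ₂, x₂⟩
      simp only [mem_filter, hQ, mem_insert, mem_singleton, Prod.mk.injEq]
      constructor
      · rintro ⟨⟨h1, h2, h3⟩, h4⟩
        have hτ₂ : τ₂ = (insert x τ).erase x₂ := by rw [← h4, Finset.erase_insert h2]
        by_cases e1 : x₂ = x
        · left; refine ⟨?_, e1⟩
          rw [hτ₂, e1, Finset.erase_insert hxτ]
        · by_cases e2 : x₂ = x'
          · right; exact ⟨by rw [hτ₂, e2], e2⟩
          · exfalso
            refine hxx' (hDinj τ₂ h1 ?_ ?_ hcx'.symm)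
            · rw [hτ₂]; simp [Ne.symm e1]
            · rw [hτ₂]; simp [Ne.symm e2, hx']
      · rintro (⟨rfl, rfl⟩ | ⟨rfl, rfl⟩)
        · exact ⟨⟨hτD, hxτ, hdom⟩, rfl⟩
        · refine ⟨⟨(hD _).2 ⟨?_, himg⟩, by simp, by rwa [hins]⟩, hins⟩
          rw [Finset.card_erase_of_mem (Finset.mem_insert_of_mem hx'),
            Finset.card_insert_of_notMem hxτ, ← hτD'.1]; rfl
    rw [this, Finset.card_pair (by simp [hxx'])]
    exact even_two
  let ω : Finset (T ⊕ I) := (univ.erase i₀).image Sum.inr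
  have hωmem : ∀ x, x ∈ ω ↔ ∃ j, j ≠ i₀ ∧ Sum.inr j = x := by simp [ω]
  have hωD : ω ∈ D := by
    rw [hD]
    constructor
    · rw [Finset.card_image_of_injective _ Sum.inr_injective,
        Finset.card_erase_of_mem (mem_univ _), Finset.card_univ]; omega
    · simp only [ω, Finset.image_image]
      ext a; simp [hc']
  have hodd : Odd Q.card := by
    rw [Finset.card_eq_sum_card_fiberwise (f := fun p => p.1) (t := D)
      (fun p hp => mem_coe.2 ((hQ p).1 hp).1), ← Finset.add_sum_erase _ _ hωD]
    have hfib : ∀ τ ∈ D, (Q.filter fun p => p.1 = τ).card =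
        (univ.filter fun x => x ∉ τ ∧ Dominant r (insert x τ)).card := by
      intro τ hτ
      refine Finset.card_bij' (fun p _ => p.2) (fun x _ => (τ, x)) ?_ ?_ ?_ ?_
      · rintro ⟨τ', x⟩ h
        simp only [mem_filter, hQ] at h
        obtain ⟨⟨-, h⟩, rfl⟩ := h
        simpa using h
      · intro x h
        simp only [mem_filter, mem_univ, true_and] at h
        simpa [hQ, hτ] using h
      · rintro ⟨τ', x⟩ h
        simp only [mem_filter] at h
        rw [← h.2]
      · intros; rfl
    refine Odd.add_even ?_ (Finset.even_sum _ fun τ hτ => ?_)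
    · rw [hfib ω hωD]
      obtain ⟨v, -, hv⟩ := (univ : Finset T).exists_max_image (fun v => r i₀ (Sum.inl v))
        Finset.univ_nonempty
      have : (univ.filter fun x => x ∉ ω ∧ Dominant r (insert x ω)) = {Sum.inl v} := by
        ext x
        simp only [mem_filter, mem_univ, true_and, mem_singleton]
        constructor
        · rintro ⟨h1, h2⟩
          have key : ∀ u : T, r i₀ (Sum.inl u) ≤ r i₀ x := by
            intro u
            obtain ⟨i, hi⟩ := h2 (Sum.inl u)
            by_cases h : i = i₀
            · subst h; exact hi x (Finset.mem_insert_self _ _)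
            · exact absurd (hi (Sum.inr i) (Finset.mem_insert_of_mem
                ((hωmem _).2 ⟨i, h, rfl⟩))) (not_le.2 (hbot i u))
          rcases x with u | j
          · exact hr i₀ (le_antisymm (hv u (mem_univ _)) (key v))
          · by_cases h : j = i₀
            · subst h; exact absurd (key v) (not_le.2 (hbot j v))
            · exact absurd ((hωmem _).2 ⟨j, h, rfl⟩) h1
        · rintro rfl
          refine ⟨by simp [ω], ?_⟩
          rintro (u | j)
          · refine ⟨i₀, fun x hx => ?_⟩
            rcases Finset.mem_insert.1 hx with rfl | hx
            · exact hv u (mem_univ _)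
            · obtain ⟨j, hj, rfl⟩ := (hωmem _).1 hx
              exact (htop i₀ j u hj).le
          · exact ⟨j, fun x _ => hbot' j x⟩
      rw [this]; simp
    · obtain ⟨hτω, hτD⟩ := Finset.mem_erase.1 hτ
      rw [hfib τ hτD]
      have hτD' := (hD _).1 hτD
      by_cases hemp : (univ.filter fun x => x ∉ τ ∧ Dominant r (insert x τ)) = ∅
      · rw [hemp]; simp
      obtain ⟨x, hx⟩ := Finset.nonempty_iff_ne_empty.2 hemp
      simp only [mem_filter, mem_univ, true_and] at hx
      obtain ⟨v, hv⟩ : ∃ v : T, Sum.inl v ∈ τ := by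
        by_contra! h
        apply hτω
        ext (v | j)
        · simp [h v, ω]
        · have : j ∈ τ.image c' ↔ Sum.inr j ∈ τ := by
            simp [hc', h]
          rw [← this, hτD'.2]
          simp [ω]
      rw [card_dominant_insert_eq_two hr (hx.2.mono (Finset.subset_insert _ _)) ⟨_, hv⟩ hτD'.1]
      · exact even_two
      · exact fun l => ⟨Sum.inr l, fun i hi => ⟨_, hv, htop i l v hi.symm⟩⟩
  exact (Nat.not_even_iff_odd.2 hodd) heven

end Dominant

section ApproxFixedPoint

variable {I : Type*} [Fintype I]

open Classical in
/-- A Sperner-type lemma on the lattice points of a simplex: some cluster of lattice points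
realises every colour outside the coordinates that nearly vanish on it. -/
theorem exists_cluster (hI : 2 ≤ Fintype.card I) (N : ℕ)
    (c : (Finset.piAntidiag (univ : Finset I) N) → I) :
    ∃ S : Finset (Finset.piAntidiag (univ : Finset I) N), S.Nonempty ∧
      (∀ v ∈ S, ∀ w ∈ S, ∀ i, v.1 i ≤ w.1 i + Fintype.card I) ∧
      ∀ i, (∃ v ∈ S, c v = i) ∨ ∀ v ∈ S, v.1 i ≤ Fintype.card I := by
  let T := Finset.piAntidiag (univ : Finset I) N
  have hmemT : ∀ v : I → ℕ, v ∈ T ↔ ∑ i, v i = N := by simp [T]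
  obtain ⟨i₀⟩ : Nonempty I := Fintype.card_pos_iff.1 (by omega)
  have : Nonempty T := ⟨⟨Pi.single i₀ N, (hmemT _).2 (by simp)⟩⟩
  let F : I → T ⊕ I → ℕ := fun i =>
    Sum.elim (fun v => v.1 i + 1) (fun j => if j = i then 0 else N + 2)
  let r : I → T ⊕ I → ℕ ×ₗ Fin (Fintype.card (T ⊕ I)) := fun i x =>
    toLex (F i x, Fintype.equivFin _ x)
  have hrF : ∀ i x y, r i x ≤ r i y → F i x ≤ F i y := by
    intro i x y h
    rcases (Prod.Lex.toLex_le_toLex).1 h with h | h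
    · exact h.le
    · exact h.1.le
  have hFr : ∀ i x y, F i x < F i y → r i x < r i y := fun i x y h =>
    Prod.Lex.toLex_lt_toLex.2 (Or.inl h)
  have hle : ∀ (v : T) i, v.1 i ≤ N := by
    intro v i
    rw [← (hmemT _).1 v.2]
    exact Finset.single_le_sum (f := v.1) (fun _ _ => Nat.zero_le _) (mem_univ i)
  obtain ⟨σ, hdom, himg⟩ := exists_dominant_image_eq_univ (r := r)
    (fun i x y h => (Fintype.equivFin _).injective (Prod.ext_iff.1 (toLex.injective h)).2)
    (fun i v => hFr _ _ _ (by simp [F]))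
    (fun i j v hj => hFr _ _ _ (by simpa [F, hj] using hle v i)) hI c
  have hcol : ∀ i, (∃ v, Sum.inl v ∈ σ ∧ c v = i) ∨ Sum.inr i ∈ σ := by
    intro i
    have : i ∈ σ.image (Sum.elim c id) := by rw [himg]; exact mem_univ _
    obtain ⟨v | j, hx, h⟩ := Finset.mem_image.1 this
    · exact Or.inl ⟨v, hx, h⟩
    · right; rwa [← show j = i from h]
  have hσne : σ.Nonempty := by
    rcases hcol i₀ with ⟨v, hv, -⟩ | h
    exacts [⟨_, hv⟩, ⟨_, h⟩]
  choose m hmσ hmin using fun i => σ.exists_min_image (F i) hσne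
  have hN : N < ∑ i, F i (m i) := by
    by_contra! hle
    let y : I → ℕ := fun i => F i (m i) + Pi.single (M := fun _ => ℕ) i₀ (N - ∑ i, F i (m i)) i
    have hy : y ∈ T := by
      rw [hmemT]
      simp only [y, Finset.sum_add_distrib, Finset.sum_pi_single', mem_univ, if_true]
      omega
    obtain ⟨i, hi⟩ := hdom (Sum.inl ⟨y, hy⟩)
    have h1 := hrF _ _ _ (hi _ (hmσ i))
    have h2 : F i (Sum.inl ⟨y, hy⟩) = y i + 1 := rfl
    have h3 : F i (m i) ≤ y i := Nat.le_add_right _ _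
    omega
  have hlow : ∀ v : T, Sum.inl v ∈ σ → ∀ i, F i (m i) ≤ v.1 i + 1 := fun v hv i => hmin i _ hv
  have hupp : ∀ v : T, Sum.inl v ∈ σ → ∀ i, v.1 i + 1 ≤ F i (m i) + Fintype.card I := by
    intro v hv i
    have h1 : ∑ j, (v.1 j + 1 - F j (m j)) + ∑ j, F j (m j) = N + Fintype.card I := by
      rw [← Finset.sum_add_distrib, Finset.sum_congr rfl
        (fun j _ => Nat.sub_add_cancel (hlow v hv j)), Finset.sum_add_distrib, (hmemT _).1 v.2]
      simp
    have h2 := Finset.single_le_sum (f := fun j => v.1 j + 1 - F j (m j))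
      (fun _ _ => Nat.zero_le _) (mem_univ i)
    omega
  refine ⟨univ.filter fun v => Sum.inl v ∈ σ, ?_, ?_, ?_⟩
  · by_contra hemp
    have h0 : ∀ i, F i (m i) = 0 := by
      intro i
      rcases hcol i with ⟨v, hv, -⟩ | h
      · exact absurd ⟨v, by simpa using hv⟩ hemp
      · have := hmin i _ h
        simpa [F] using this
    simp [h0] at hN
  · intro v hv w hw i
    have h1 := hupp v (by simpa using hv) i
    have h2 := hlow w (by simpa using hw) i
    omega
  · intro i
    rcases hcol i with ⟨v, hv, hcv⟩ | h
    · exact Or.inl ⟨v, by simpa using hv, hcv⟩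
    · right
      intro v hv
      have h1 := hupp v (by simpa using hv) i
      have h2 : F i (m i) ≤ 0 := by simpa [F] using hmin i _ h
      omega

/-- **Brouwer's theorem**, approximate form, for continuous self-maps of the simplex. -/
theorem exists_approx_fixedPoint (hI : 2 ≤ Fintype.card I) {f : (I → ℝ) → I → ℝ}
    (hf : ContinuousOn f (stdSimplex ℝ I)) (hmap : Set.MapsTo f (stdSimplex ℝ I) (stdSimplex ℝ I))
    {η : ℝ} (hη : 0 < η) : ∃ x ∈ stdSimplex ℝ I, ∀ i, x i ≤ f x i + η := by
  classical
  obtain ⟨d, hd, hfd⟩ := Metric.uniformContinuousOn_iff.1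
    ((isCompact_stdSimplex ℝ I).uniformContinuousOn_of_continuous hf) (η / 2) (by linarith)
  obtain ⟨N, hN⟩ := exists_nat_gt ((Fintype.card I : ℝ) / min d (η / 2))
  have hmin : 0 < min d (η / 2) := lt_min hd (by linarith)
  have hN0 : (0 : ℝ) < N := lt_of_le_of_lt (by positivity) hN
  have hkN : (Fintype.card I : ℝ) / N < min d (η / 2) := by
    rw [div_lt_iff₀ hmin] at hN
    rw [div_lt_iff₀ hN0]; linarith
  let p : Finset.piAntidiag (univ : Finset I) N → I → ℝ := fun v i => v.1 i / N
  have hp : ∀ v, p v ∈ stdSimplex ℝ I := by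
    intro v
    refine ⟨fun i => by positivity, ?_⟩
    have hv : ∑ i, v.1 i = N := (Finset.mem_piAntidiag.1 v.2).1
    simp only [p]
    rw [← Finset.sum_div, ← Nat.cast_sum, hv, div_self hN0.ne']
  have hcol : ∀ v, ∃ i, p v i ≤ f (p v) i := by
    intro v
    obtain ⟨i₀⟩ : Nonempty I := Fintype.card_pos_iff.1 (by omega)
    obtain ⟨i, -, hi⟩ := Finset.exists_le_of_sum_le (s := univ) (f := p v) (g := f (p v))
      ⟨i₀, mem_univ _⟩ (by rw [(hp v).2, (hmap (hp v)).2])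
    exact ⟨i, hi⟩
  choose c hc using hcol
  obtain ⟨S, ⟨w, hw⟩, hclose, hS⟩ := exists_cluster hI N c
  have hpclose : ∀ v ∈ S, ∀ u ∈ S, ∀ i, p v i ≤ p u i + Fintype.card I / N := by
    intro v hv u hu i
    simp only [p]
    rw [← add_div]
    gcongr
    exact_mod_cast hclose v hv u hu i
  refine ⟨p w, hp w, fun i => ?_⟩
  have hkη := hkN.trans_le (min_le_right _ _)
  rcases hS i with ⟨v, hv, rfl⟩ | h
  · have hdist : dist (p v) (p w) < d := by
      refine lt_of_le_of_lt ((dist_pi_le_iff (by positivity)).2 fun j => ?_)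
        (hkN.trans_le (min_le_left _ _))
      rw [Real.dist_eq, abs_le]
      constructor <;> linarith [hpclose v hv w hw j, hpclose w hw v hv j]
    have h1 := (dist_le_pi_dist (f (p v)) (f (p w)) (c v)).trans_lt (hfd _ (hp v) _ (hp w) hdist)
    rw [Real.dist_eq, abs_lt] at h1
    linarith [hpclose w hw v hv (c v), hc v]
  · have h1 : p w i ≤ Fintype.card I / N := by
      simp only [p]
      gcongr
      exact_mod_cast h w hw
    linarith [(hmap (hp w)).1 i]

end ApproxFixedPoint

open Classical in
/-- Rounding of mixed strategies (Shapley–Folkman): there is a pure profile, supported by the given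
mixed strategies, whose action counts are close to the expected ones. -/
theorem exists_rounding {ι κ : Type} [Fintype ι] [Nonempty ι] [Fintype κ] {q : ι → κ → ℝ}
    (hq : ∀ i, q i ∈ stdSimplex ℝ κ) :
    ∃ a : ι → κ, (∀ i, 0 < q i (a i)) ∧
      ∑ x, |((univ.filter fun i => a i = x).card : ℝ) - ∑ i, q i x| ≤
        2 * (Fintype.card κ + 1) := by
  set n : ℝ := (Fintype.card ι : ℝ) with hn
  have hn0 : 0 < n := by rw [hn]; exact_mod_cast Fintype.card_pos
  let V : ι × κ → (ι ⊕ κ → ℝ) := fun p =>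
    Sum.elim (fun i => if p.1 = i then 1 else 0) (fun x => if p.2 = x then 1 else 0)
  let t : Finset (ι × κ) := univ.filter fun p => 0 < q p.1 p.2
  have ht : ∀ g : ι × κ → ℝ, ∑ p ∈ t, q p.1 p.2 / n * g p = ∑ i, ∑ x, q i x / n * g (i, x) := by
    intro g
    rw [← Fintype.sum_prod_type', Finset.sum_filter_of_ne]
    intro p _ hp
    refine lt_of_le_of_ne ((hq p.1).1 p.2) fun h => hp ?_
    rw [← h]; simp
  have hsum : ∀ i, ∑ x, q i x / n = 1 / n := fun i => by rw [← Finset.sum_div, (hq i).2]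
  have hmem : ∑ p ∈ t, (q p.1 p.2 / n) • V p ∈ convexHull ℝ (V '' t) := by
    refine (convex_convexHull ℝ _).sum_mem (fun p _ => div_nonneg ((hq p.1).1 p.2) hn0.le) ?_
      fun p hp => subset_convexHull ℝ _ ⟨p, hp, rfl⟩
    have := ht fun _ => 1
    simp only [mul_one] at this
    rw [this, Finset.sum_congr rfl fun i _ => hsum i]
    simp only [sum_const, card_univ, nsmul_eq_mul, ← hn]
    field_simp
  obtain ⟨J, _, z, w, hz, hind, hw0, -, hw⟩ := eq_pos_convex_span_of_mem_convexHull hmem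
  have hJ : Fintype.card J ≤ Fintype.card ι + Fintype.card κ + 1 := by
    refine hind.card_le_finrank_succ.trans ?_
    have := Submodule.finrank_le (vectorSpan ℝ (Set.range z))
    rw [Module.finrank_pi, Fintype.card_sum] at this
    omega
  choose e het hez using fun j => hz ⟨j, rfl⟩
  have he : ∀ j, 0 < q (e j).1 (e j).2 := fun j => by simpa [t] using het j
  have hpl : ∀ i, ∑ j, w j * (if (e j).1 = i then 1 else 0) = 1 / n := by
    intro i
    have h := congrFun hw (Sum.inl i)
    simp only [Finset.sum_apply, Pi.smul_apply, smul_eq_mul, ← hez] at h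
    rw [ht fun p => V p (Sum.inl i)] at h
    simp only [V, Sum.elim_inl] at h
    rw [h, Finset.sum_eq_single i]
    · simpa using hsum i
    · intro b _ hb; simp [hb]
    · simp
  have hac : ∀ x, ∑ j, w j * (if (e j).2 = x then 1 else 0) = (∑ i, q i x) / n := by
    intro x
    have h := congrFun hw (Sum.inr x)
    simp only [Finset.sum_apply, Pi.smul_apply, smul_eq_mul, ← hez] at h
    rw [ht fun p => V p (Sum.inr x)] at h
    simp only [V, Sum.elim_inr] at h
    rw [h, Finset.sum_div]
    simp
  have hex : ∀ i, ∃ j, (e j).1 = i := by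
    intro i
    by_contra! h
    have := hpl i
    simp only [h, if_false, mul_zero, Finset.sum_const_zero] at this
    have : 0 < 1 / n := by positivity
    linarith
  choose s hs using hex
  have hwle : ∀ j, w j ≤ 1 / n := by
    intro j
    rw [← hpl (e j).1]
    refine le_trans (by simp) (Finset.single_le_sum
      (f := fun l => w l * (if (e l).1 = (e j).1 then (1 : ℝ) else 0)) (fun l _ => ?_) (mem_univ j))
    have := (hw0 l).le
    positivity
  refine ⟨fun i => (e (s i)).2, fun i => by simpa [hs] using he (s i), ?_⟩
  have hdiff : ∀ x, ((univ.filter fun i => (e (s i)).2 = x).card : ℝ) - ∑ i, q i x =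
      n * ∑ j, w j * ((if (e (s (e j).1)).2 = x then 1 else 0) - if (e j).2 = x then 1 else 0) := by
    intro x
    have h1 : ((univ.filter fun i => (e (s i)).2 = x).card : ℝ) =
        n * ∑ j, w j * (if (e (s (e j).1)).2 = x then 1 else 0) := by
      have : ∀ j, w j * (if (e (s (e j).1)).2 = x then (1 : ℝ) else 0) =
          ∑ i, (w j * if (e j).1 = i then 1 else 0) * if (e (s i)).2 = x then 1 else 0 := by
        intro j
        rw [Finset.sum_eq_single (e j).1]
        · simp
        · intro b _ hb; simp [hb.symm]
        · simp
      rw [Finset.sum_congr rfl fun j _ => this j, Finset.sum_comm]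
      simp only [← Finset.sum_mul, hpl]
      rw [← Finset.mul_sum, ← mul_assoc, mul_one_div_cancel hn0.ne', one_mul]
      simp
    have h2 : ∑ i, q i x = n * ∑ j, w j * (if (e j).2 = x then 1 else 0) := by
      rw [hac, mul_div_cancel₀ _ hn0.ne']
    rw [h1, h2, ← mul_sub, ← Finset.sum_sub_distrib]
    simp only [mul_sub]
  have hbad : ((univ.filter fun j => s (e j).1 ≠ j).card : ℝ) ≤ Fintype.card κ + 1 := by
    have hinj : Function.Injective s := fun i i' h => by rw [← hs i, h, hs]
    have h1 : Fintype.card ι ≤ (univ.filter fun j => s (e j).1 = j).card := by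
      rw [← Finset.card_univ]
      exact Finset.card_le_card_of_injOn s (fun i _ => by simp [hs]) hinj.injOn
    have h2 := Finset.card_filter_add_card_filter_not (s := (univ : Finset J))
      (fun j => s (e j).1 = j)
    rw [Finset.card_univ] at h2
    have : (univ.filter fun j => s (e j).1 ≠ j).card ≤ Fintype.card κ + 1 := by
      simp only [ne_eq]; omega
    exact_mod_cast this
  calc ∑ x, |((univ.filter fun i => (e (s i)).2 = x).card : ℝ) - ∑ i, q i x|
      ≤ ∑ x, ∑ j, (if s (e j).1 ≠ j then 1 else 0) *
          ((if (e (s (e j).1)).2 = x then (1 : ℝ) else 0) + if (e j).2 = x then 1 else 0) := by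
        refine Finset.sum_le_sum fun x _ => ?_
        rw [hdiff, abs_mul, abs_of_pos hn0]
        refine (mul_le_mul_of_nonneg_left (Finset.abs_sum_le_sum_abs _ _) hn0.le).trans ?_
        rw [Finset.mul_sum]
        refine Finset.sum_le_sum fun j _ => ?_
        by_cases h : s (e j).1 = j
        · simp [h]
        · have hnw : n * w j ≤ 1 := by
            have := mul_le_mul_of_nonneg_left (hwle j) hn0.le
            rwa [mul_one_div_cancel hn0.ne'] at this
          rw [abs_mul, abs_of_pos (hw0 j), ← mul_assoc]
          simp only [ne_eq, h, not_false_eq_true, if_true]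
          refine mul_le_mul hnw ?_ (abs_nonneg _) zero_le_one
          refine (abs_sub _ _).trans (le_of_eq ?_)
          rw [abs_of_nonneg, abs_of_nonneg] <;> split_ifs <;> norm_num
    _ = ∑ j, (if s (e j).1 ≠ j then 1 else 0) * 2 := by
        rw [Finset.sum_comm]
        refine Finset.sum_congr rfl fun j _ => ?_
        rw [← Finset.mul_sum, Finset.sum_add_distrib]
        norm_num
    _ = 2 * (univ.filter fun j => s (e j).1 ≠ j).card := by
        rw [← Finset.sum_mul, mul_comm, Finset.sum_boole]
    _ ≤ 2 * (Fintype.card κ + 1) := by linarith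

section ProdExp

variable {ι κ : Type*} [Fintype ι] [DecidableEq ι] [Fintype κ]

/-- The expectation of `F` when the coordinates are independent with weights `w`. -/
noncomputable def prodExp (w : ι → κ → ℝ) (F : (ι → κ) → ℝ) : ℝ :=
  ∑ b : ι → κ, (∏ l, w l (b l)) * F b

theorem prodExp_eq_sum_funSplitAt (w : ι → κ → ℝ) (F : (ι → κ) → ℝ) (j : ι) :
    prodExp w F = ∑ y, w j y * ∑ b : {l // l ≠ j} → κ,
      (∏ l, w l.1 (b l)) * F ((Equiv.funSplitAt j κ).symm (y, b)) := by
  rw [prodExp, ← (Equiv.funSplitAt j κ).symm.sum_comp, Fintype.sum_prod_type]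
  refine Finset.sum_congr rfl fun y _ => ?_
  rw [Finset.mul_sum]
  refine Finset.sum_congr rfl fun b _ => ?_
  rw [Fintype.prod_eq_mul_prod_subtype_ne _ j, ← mul_assoc]
  congr 2
  · simp
  · refine Finset.prod_congr rfl fun l _ => ?_
    simp [l.2]

/-- Changing the weights of one coordinate amounts to resampling it. -/
theorem prodExp_update (w : ι → κ → ℝ) (F : (ι → κ) → ℝ) (j : ι) (τ : κ → ℝ)
    (hw : ∑ y, w j y = 1) :
    prodExp (Function.update w j τ) F =
      ∑ y, τ y * prodExp w fun b => F (Function.update b j y) := by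
  rw [prodExp_eq_sum_funSplitAt _ _ j, Function.update_self]
  refine Finset.sum_congr rfl fun y _ => ?_
  congr 1
  rw [prodExp_eq_sum_funSplitAt _ _ j]
  have : ∀ z : κ, ∑ b : {l // l ≠ j} → κ, (∏ l, w l.1 (b l)) *
      F (Function.update ((Equiv.funSplitAt j κ).symm (z, b)) j y) =
      ∑ b : {l // l ≠ j} → κ, (∏ l, w l.1 (b l)) * F ((Equiv.funSplitAt j κ).symm (y, b)) := by
    intro z
    refine Finset.sum_congr rfl fun b _ => ?_
    congr 2
    ext l
    by_cases h : l = j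
    · subst h; simp
    · simp [h]
  simp only [this]
  rw [← Finset.sum_mul, hw, one_mul]
  refine Finset.sum_congr rfl fun b _ => ?_
  congr 1
  refine Finset.prod_congr rfl fun l _ => ?_
  rw [Function.update_of_ne l.2]

theorem prodExp_resample (w : ι → κ → ℝ) (F : (ι → κ) → ℝ) (j : ι) (hw : ∑ y, w j y = 1) :
    prodExp w F = ∑ y, w j y * prodExp w fun b => F (Function.update b j y) := by
  rw [← prodExp_update w F j (w j) hw, Function.update_eq_self]

theorem prodExp_add (w : ι → κ → ℝ) (F G : (ι → κ) → ℝ) :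
    prodExp w (fun b => F b + G b) = prodExp w F + prodExp w G := by
  simp only [prodExp, mul_add, Finset.sum_add_distrib]

theorem prodExp_sub (w : ι → κ → ℝ) (F G : (ι → κ) → ℝ) :
    prodExp w (fun b => F b - G b) = prodExp w F - prodExp w G := by
  simp only [prodExp, mul_sub, Finset.sum_sub_distrib]

theorem prodExp_const_mul (w : ι → κ → ℝ) (c : ℝ) (F : (ι → κ) → ℝ) :
    prodExp w (fun b => c * F b) = c * prodExp w F := by
  simp only [prodExp, Finset.mul_sum]
  exact Finset.sum_congr rfl fun b _ => by ring

theorem prodExp_sum {α : Type*} (s : Finset α) (w : ι → κ → ℝ) (F : α → (ι → κ) → ℝ) :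
    prodExp w (fun b => ∑ a ∈ s, F a b) = ∑ a ∈ s, prodExp w (F a) := by
  simp only [prodExp, Finset.mul_sum]
  exact Finset.sum_comm

theorem prodExp_const {w : ι → κ → ℝ} (hw : ∀ l, ∑ y, w l y = 1) (c : ℝ) :
    prodExp w (fun _ => c) = c := by
  classical
  have h := Finset.prod_univ_sum (fun _ : ι => (univ : Finset κ)) w
  simp only [hw, Finset.prod_const_one, Fintype.piFinset_univ] at h
  rw [prodExp, ← Finset.sum_mul, ← h, one_mul]

theorem prodExp_mono {w : ι → κ → ℝ} (hw : ∀ l y, 0 ≤ w l y) {F G : (ι → κ) → ℝ}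
    (h : ∀ b, F b ≤ G b) : prodExp w F ≤ prodExp w G :=
  Finset.sum_le_sum fun b _ =>
    mul_le_mul_of_nonneg_left (h b) (Finset.prod_nonneg fun l _ => hw l _)

theorem prodExp_mem_Icc {w : ι → κ → ℝ} (hw : ∀ l y, 0 ≤ w l y) (hw1 : ∀ l, ∑ y, w l y = 1)
    {F : (ι → κ) → ℝ} (h : ∀ b, F b ∈ Set.Icc (0 : ℝ) 1) :
    prodExp w F ∈ Set.Icc (0 : ℝ) 1 := by
  constructor
  · rw [← prodExp_const hw1 0]; exact prodExp_mono hw fun b => (h b).1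
  · rw [← prodExp_const hw1 1]; exact prodExp_mono hw fun b => (h b).2

theorem prodExp_coord {w : ι → κ → ℝ} (hw : ∀ l, ∑ y, w l y = 1) (j : ι) (φ : κ → ℝ) :
    prodExp w (fun b => φ (b j)) = ∑ y, w j y * φ y := by
  rw [prodExp_resample w _ j (hw j)]
  simp only [Function.update_self, prodExp_const hw]

/-- The variance of a sum of centred functions of independent coordinates. -/
theorem prodExp_sq_sum {w : ι → κ → ℝ} (hw : ∀ l, ∑ y, w l y = 1) (S : Finset ι)
    (φ : ι → κ → ℝ) (hφ : ∀ l ∈ S, ∑ y, w l y * φ l y = 0) :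
    prodExp w (fun b => (∑ l ∈ S, φ l (b l)) ^ 2) = ∑ l ∈ S, ∑ y, w l y * φ l y ^ 2 := by
  simp only [sq, Finset.sum_mul_sum]
  rw [prodExp_sum]
  refine Finset.sum_congr rfl fun l hl => ?_
  rw [prodExp_sum, Finset.sum_eq_single l]
  · exact prodExp_coord hw l fun y => φ l y * φ l y
  · intro l' _ hne
    rw [prodExp_resample w _ l (hw l)]
    simp only [Function.update_self, Function.update_of_ne hne, prodExp_const_mul, ← mul_assoc]
    rw [← Finset.sum_mul, hφ l hl, zero_mul]
  · exact fun h => absurd hl h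

/-- A Cauchy–Schwarz bound for the correlation of a bounded function with a sum of centred
functions of independent coordinates. -/
theorem abs_prodExp_mul_sum_le {w : ι → κ → ℝ} (hw0 : ∀ l y, 0 ≤ w l y)
    (hw : ∀ l, ∑ y, w l y = 1) (S : Finset ι) (φ : ι → κ → ℝ)
    (hφ : ∀ l ∈ S, ∑ y, w l y * φ l y = 0) {t : ℝ} (ht : 0 < t)
    (hvar : ∑ l ∈ S, ∑ y, w l y * φ l y ^ 2 ≤ t ^ 2) {G : (ι → κ) → ℝ} (hG : ∀ b, |G b| ≤ 1) :
    |prodExp w fun b => G b * ∑ l ∈ S, φ l (b l)| ≤ t := by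
  have key : ∀ b, |G b * ∑ l ∈ S, φ l (b l)| ≤
      t / 2 + 1 / (2 * t) * (∑ l ∈ S, φ l (b l)) ^ 2 := by
    intro b
    set X := ∑ l ∈ S, φ l (b l)
    have h1 : |G b * X| ≤ |X| := by
      rw [abs_mul]; exact mul_le_of_le_one_left (abs_nonneg _) (hG b)
    have h2 : t / 2 + 1 / (2 * t) * X ^ 2 - |X| = (t - |X|) ^ 2 / (2 * t) := by
      rw [← sq_abs X]; field_simp; ring
    have h3 : 0 ≤ (t - |X|) ^ 2 / (2 * t) := by positivity
    linarith
  have hbound : prodExp w (fun b => t / 2 + 1 / (2 * t) * (∑ l ∈ S, φ l (b l)) ^ 2) ≤ t := by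
    rw [prodExp_add, prodExp_const hw, prodExp_const_mul, prodExp_sq_sum hw S φ hφ]
    have : 1 / (2 * t) * ∑ l ∈ S, ∑ y, w l y * φ l y ^ 2 ≤ 1 / (2 * t) * t ^ 2 :=
      mul_le_mul_of_nonneg_left hvar (by positivity)
    have h2 : 1 / (2 * t) * t ^ 2 = t / 2 := by field_simp
    linarith
  rw [abs_le]
  constructor
  · have := prodExp_mono hw0 fun b => (neg_le_of_abs_le (key b))
    have h2 := prodExp_const_mul w (-1) (fun b => t / 2 + 1 / (2 * t) * (∑ l ∈ S, φ l (b l)) ^ 2)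
    simp only [neg_one_mul] at h2
    linarith
  · exact (prodExp_mono hw0 fun b => (le_of_abs_le (key b))).trans hbound

/-- If swapping the values of two coordinates turns `G` into `H`, then `G` and `H` have nearly the
same expectation, as soon as each of the many coordinates in `S` takes both values `x`, `y` with
probability at least `ρ`. -/
theorem abs_prodExp_sub_le [DecidableEq κ] {w : ι → κ → ℝ} (hw0 : ∀ l y, 0 ≤ w l y)
    (hw : ∀ l, ∑ y, w l y = 1) {S : Finset ι} (hS : S.Nonempty) {ρ : ℝ} (hρ : 0 < ρ)
    {x y : κ} (hx : ∀ l ∈ S, ρ ≤ w l x) (hy : ∀ l ∈ S, ρ ≤ w l y)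
    {G H : (ι → κ) → ℝ} (hG : ∀ b, |G b| ≤ 1) (hH : ∀ b, |H b| ≤ 1)
    (hGH : ∀ b, ∀ l ∈ S, G (Function.update b l y) = H (Function.update b l x)) :
    |prodExp w G - prodExp w H| ≤ 2 * √(1 / (ρ * S.card)) := by
  have hm : (0 : ℝ) < S.card := by exact_mod_cast hS.card_pos
  have hcent : ∀ z : κ, (∀ l ∈ S, ρ ≤ w l z) → ∀ l ∈ S,
      ∑ u, w l u * (1 - (if u = z then 1 / w l z else 0)) = 0 := by
    intro z hz l hl
    have : w l z ≠ 0 := (hρ.trans_le (hz l hl)).ne'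
    simp only [mul_sub, mul_one, Finset.sum_sub_distrib, hw]
    simp [this]
  have hvar : ∀ z : κ, (∀ l ∈ S, ρ ≤ w l z) →
      ∑ l ∈ S, ∑ u, w l u * (1 - (if u = z then 1 / w l z else 0)) ^ 2 ≤ √(S.card / ρ) ^ 2 := by
    intro z hz
    rw [Real.sq_sqrt (by positivity), div_eq_mul_one_div, ← nsmul_eq_mul]
    refine Finset.sum_le_card_nsmul _ _ _ fun l hl => ?_
    have hpos : 0 < w l z := hρ.trans_le (hz l hl)
    have h1 : ∀ u, w l u * (1 - (if u = z then 1 / w l z else 0)) ^ 2 =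
        w l u - 2 * (if u = z then 1 else 0) + (if u = z then 1 / w l z else 0) := by
      intro u
      split_ifs with h
      · subst h; field_simp; ring
      · ring
    simp only [h1, Finset.sum_add_distrib, Finset.sum_sub_distrib, hw, ← Finset.mul_sum]
    simp only [Finset.sum_ite_eq', mem_univ, if_true]
    have := one_div_le_one_div_of_le hρ (hz l hl)
    linarith
  have hsel : ∀ z : κ, (∀ l ∈ S, ρ ≤ w l z) → ∀ F : (ι → κ) → ℝ,
      prodExp w (fun b => F b * ∑ l ∈ S, (1 - (if b l = z then 1 / w l z else 0))) =
        S.card * prodExp w F - ∑ l ∈ S, prodExp w fun b => F (Function.update b l z) := by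
    intro z hz F
    simp only [Finset.mul_sum]
    rw [prodExp_sum, ← nsmul_eq_mul, ← Finset.sum_const, ← Finset.sum_sub_distrib]
    refine Finset.sum_congr rfl fun l hl => ?_
    have hpos : 0 < w l z := hρ.trans_le (hz l hl)
    simp only [mul_sub, mul_one]
    rw [prodExp_sub]
    congr 1
    rw [prodExp_resample w _ l (hw l), Finset.sum_eq_single z]
    · simp only [Function.update_self, if_true]
      rw [← prodExp_const_mul]
      congr 1
      ext b
      field_simp
    · intro u _ hu
      simp [hu, prodExp]
    · simp
  have e1 := abs_prodExp_mul_sum_le hw0 hw S (fun l u => 1 - (if u = y then 1 / w l y else 0))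
    (hcent y hy) (t := √(S.card / ρ)) (by positivity) (hvar y hy) hG
  have e2 := abs_prodExp_mul_sum_le hw0 hw S (fun l u => 1 - (if u = x then 1 / w l x else 0))
    (hcent x hx) (t := √(S.card / ρ)) (by positivity) (hvar x hx) hH
  rw [hsel y hy G] at e1
  rw [hsel x hx H] at e2
  have e3 : ∑ l ∈ S, prodExp w (fun b => G (Function.update b l y)) =
      ∑ l ∈ S, prodExp w fun b => H (Function.update b l x) :=
    Finset.sum_congr rfl fun l hl => by simp only [hGH _ l hl]
  have e4 : (S.card : ℝ) * |prodExp w G - prodExp w H| ≤ 2 * √(S.card / ρ) := by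
    rw [← abs_of_pos hm, ← abs_mul, abs_of_pos hm]
    rw [abs_le] at e1 e2 ⊢
    constructor <;> linarith [e1.1, e1.2, e2.1, e2.2]
  have e5 : √(S.card / ρ) = S.card * √(1 / (ρ * S.card)) := by
    rw [show (S.card : ℝ) / ρ = S.card ^ 2 * (1 / (ρ * S.card)) by field_simp,
      Real.sqrt_mul (by positivity), Real.sqrt_sq hm.le]
  rw [e5] at e4
  refine le_of_mul_le_mul_left (e4.trans (le_of_eq ?_)) hm
  ring

end ProdExp

theorem actCount_eq_sum {n k : ℕ} (a : Fin n → Fin k) (x : Fin k) :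
    actCount n k a x = ∑ i, if a i = x then 1 else 0 := by
  simp [actCount]

theorem sum_actCount {n k : ℕ} (a : Fin n → Fin k) : ∑ x, actCount n k a x = n := by
  simp only [actCount_eq_sum]
  rw [Finset.sum_comm]
  simp

theorem actCount_update {n k : ℕ} (a : Fin n → Fin k) (j : Fin n) (p x : Fin k) :
    actCount n k (Function.update a j p) x + (if a j = x then 1 else 0) =
      actCount n k a x + if p = x then 1 else 0 := by
  rw [actCount_eq_sum, actCount_eq_sum, ← Finset.add_sum_erase _ _ (mem_univ j),
    ← Finset.add_sum_erase univ (fun i => if a i = x then 1 else 0) (mem_univ j),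
    Function.update_self, Finset.sum_congr rfl (g := fun i => if a i = x then 1 else 0)
    fun i hi => by rw [Function.update_of_ne (Finset.ne_of_mem_erase hi)]]
  ring

/-- In an anonymous Lipschitz game, payoffs are Lipschitz in the vector of action counts. -/
theorem abs_sub_le_mul_sum_actCount {n k : ℕ} {u : (Fin n → Fin k) → Fin n → ℝ}
    (hu : IsAnonymous n k u) {L : ℝ} (hL : 0 ≤ L)
    (hlip : ∀ a i j p, j ≠ i → |u (Function.update a j p) i - u a i| ≤ L)
    {a b : Fin n → Fin k} {i : Fin n} (hab : a i = b i) :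
    |u a i - u b i| ≤ L * ∑ x, |(actCount n k a x : ℝ) - actCount n k b x| := by
  have key : ∀ D : ℕ, ∀ a : Fin n → Fin k, a i = b i →
      ∑ x, ((actCount n k a x : ℤ) - actCount n k b x).natAbs ≤ D → |u a i - u b i| ≤ L * D := by
    intro D
    induction D with
    | zero =>
      intro a hab h
      have h0 : ∀ x, actCount n k a x = actCount n k b x := by
        intro x
        have := Finset.sum_eq_zero_iff.1 (Nat.le_zero.1 h) x (mem_univ x)
        omega
      rw [hu a b i hab h0]; simp
    | succ D ih =>
      intro a hab h
      by_cases heq : ∀ x, actCount n k a x = actCount n k b x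
      · rw [hu a b i hab heq, sub_self, abs_zero]; positivity
      have hsum := (sum_actCount a).trans (sum_actCount b).symm
      obtain ⟨p, hp⟩ : ∃ p, actCount n k b p < actCount n k a p := by
        by_contra! hle
        exact heq fun x => (Finset.sum_eq_sum_iff_of_le fun x _ => hle x).1 hsum x (mem_univ x)
      obtain ⟨q, hq⟩ : ∃ q, actCount n k a q < actCount n k b q := by
        by_contra! hle
        exact heq fun x =>
          ((Finset.sum_eq_sum_iff_of_le fun x _ => hle x).1 hsum.symm x (mem_univ x)).symm
      obtain ⟨j, hji, hj⟩ : ∃ j, j ≠ i ∧ a j = p := by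
        by_contra! hne
        have h1 : actCount n k a p ≤ actCount n k b p := by
          refine Finset.card_le_card fun l hl => ?_
          simp only [mem_filter, mem_univ, true_and] at hl ⊢
          by_cases hli : l = i
          · rw [hli, ← hab, ← hli, hl]
          · exact absurd hl (hne l hli)
        omega
      have hpq : p ≠ q := by rintro rfl; omega
      have hD : ∑ x, ((actCount n k (Function.update a j q) x : ℤ) - actCount n k b x).natAbs
          ≤ D := by
        have hpt : ∀ x ∈ (univ : Finset (Fin k)),
            ((actCount n k (Function.update a j q) x : ℤ) - actCount n k b x).natAbs +
            ((if p = x then 1 else 0) + if q = x then 1 else 0) ≤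
            ((actCount n k a x : ℤ) - actCount n k b x).natAbs := by
          intro x _
          have h1 := actCount_update a j q x
          rw [hj] at h1
          by_cases hpx : p = x
          · subst hpx
            simp only [if_true, if_neg hpq.symm] at h1 ⊢
            omega
          · by_cases hqx : q = x
            · subst hqx
              simp only [if_true, if_neg hpq] at h1 ⊢
              omega
            · simp only [if_neg hpx, if_neg hqx] at h1 ⊢
              omega
        have h2 := Finset.sum_le_sum hpt
        simp only [Finset.sum_add_distrib, Finset.sum_ite_eq, mem_univ, if_true] at h2
        omega
      have h3 := ih (Function.update a j q) (by rwa [Function.update_of_ne hji.symm]) hD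
      have h4 := hlip a i j q hji
      rw [abs_sub_comm] at h4
      calc |u a i - u b i| ≤ |u a i - u (Function.update a j q) i| +
            |u (Function.update a j q) i - u b i| := abs_sub_le _ _ _
        _ ≤ L * (D + 1 : ℕ) := by push_cast; linarith
  refine (key _ a hab le_rfl).trans (le_of_eq ?_)
  simp [Nat.cast_natAbs]

/-- Lipschitz anonymous games have approximate pure Nash equilibria. -/
theorem exists_pure_approx_nash {n k : ℕ} (hn : 1 ≤ n) (hk : 2 ≤ k)
    {u : (Fin n → Fin k) → Fin n → ℝ} (hu : IsAnonymous n k u) {L : ℝ} (hL : 0 < L)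
    (hlip : ∀ a i j p, j ≠ i → |u (Function.update a j p) i - u a i| ≤ L) :
    ∃ a : Fin n → Fin k, ∀ i x, u (Function.update a i x) i ≤ u a i + L * (8 * k + 7) := by
  have : Nonempty (Fin n) := ⟨⟨0, hn⟩⟩
  have : Nonempty (Fin k) := ⟨⟨0, by omega⟩⟩
  have hn0 : (0 : ℝ) < n := by exact_mod_cast hn
  let d : (Fin n → Fin k) → (Fin k → ℝ) → ℝ := fun a y => ∑ x, |(actCount n k a x : ℝ) - y x|
  let v : Fin n → Fin k → (Fin k → ℝ) → ℝ := fun i x y =>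
    (univ : Finset (Fin n → Fin k)).sup' Finset.univ_nonempty fun a =>
      u (Function.update a i x) i - L * d (Function.update a i x) y
  have hv : ∀ i a y, |v i (a i) y - u a i| ≤ L * d a y := by
    intro i a y
    rw [abs_le]
    constructor
    · have := Finset.le_sup' (fun a' => u (Function.update a' i (a i)) i -
        L * d (Function.update a' i (a i)) y) (mem_univ a)
      rw [Function.update_eq_self] at this
      simp only [v]
      linarith
    · rw [sub_le_iff_le_add]
      refine Finset.sup'_le _ _ fun a' _ => ?_
      have h1 := le_of_abs_le (abs_sub_le_mul_sum_actCount hu hL.le hlip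
        (a := Function.update a' i (a i)) (b := a) (i := i) (by simp))
      have h2 : ∑ x, |(actCount n k (Function.update a' i (a i)) x : ℝ) - actCount n k a x| ≤
          d (Function.update a' i (a i)) y + d a y := by
        simp only [d, ← Finset.sum_add_distrib]
        refine Finset.sum_le_sum fun x _ => ?_
        rw [abs_sub_comm (actCount n k a x : ℝ)]
        exact abs_sub_le _ _ _
      have h3 := mul_le_mul_of_nonneg_left h2 hL.le
      linarith
  have hvc : ∀ i x, Continuous (v i x) := fun i x =>
    Continuous.finset_sup'_apply _ fun a _ => by fun_prop
  let M : Fin n → (Fin k → ℝ) → ℝ := fun i y =>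
    (univ : Finset (Fin k)).sup' Finset.univ_nonempty fun x => v i x y
  have hMc : ∀ i, Continuous (M i) := fun i =>
    Continuous.finset_sup'_apply _ fun x _ => hvc i x
  let e : Fin n → Fin k → (Fin k → ℝ) → ℝ := fun i x y => max 0 (v i x y - M i y + L)
  have hec : ∀ i x, Continuous (e i x) := fun i x =>
    continuous_const.max (((hvc i x).sub (hMc i)).add continuous_const)
  have he0 : ∀ i x y, 0 ≤ e i x y := fun i x y => le_max_left _ _
  have hes : ∀ i y, 0 < ∑ x, e i x y := by
    intro i y
    obtain ⟨x, -, hx⟩ := Finset.exists_mem_eq_sup' (Finset.univ_nonempty (α := Fin k))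
      fun x => v i x y
    refine Finset.sum_pos' (fun x _ => he0 i x y) ⟨x, mem_univ _, lt_max_of_lt_right ?_⟩
    have : M i y = v i x y := hx
    linarith
  let q : (Fin k → ℝ) → Fin n → Fin k → ℝ := fun y i x => e i x y / ∑ x', e i x' y
  have hq : ∀ y i, q y i ∈ stdSimplex ℝ (Fin k) := fun y i =>
    ⟨fun x => div_nonneg (he0 i x y) (hes i y).le, by
      simp only [q]; rw [← Finset.sum_div, div_self (hes i y).ne']⟩
  have hqc : ∀ i x, Continuous fun y => q y i x := fun i x =>
    (hec i x).div (continuous_finsetSum _ fun x' _ => hec i x') fun y => (hes i y).ne'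
  let F : (Fin k → ℝ) → Fin k → ℝ := fun s x => (∑ i, q ((n : ℝ) • s) i x) / n
  have hFc : Continuous F := continuous_pi fun x => Continuous.div_const
    (continuous_finsetSum _ fun i _ => (hqc i x).comp (continuous_const_smul _)) _
  have hsumQ : ∀ y, ∑ x, ∑ i, q y i x = n := by
    intro y
    rw [Finset.sum_comm, Finset.sum_congr rfl fun i _ => (hq y i).2]
    simp
  have hFm : Set.MapsTo F (stdSimplex ℝ (Fin k)) (stdSimplex ℝ (Fin k)) := by
    intro s _
    refine ⟨fun x => div_nonneg (Finset.sum_nonneg fun i _ => (hq _ i).1 x) hn0.le, ?_⟩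
    simp only [F]
    rw [← Finset.sum_div, hsumQ, div_self hn0.ne']
  obtain ⟨s, hs, hfix⟩ := exists_approx_fixedPoint (by simpa using hk) hFc.continuousOn hFm
    (one_div_pos.2 hn0)
  set y : Fin k → ℝ := (n : ℝ) • s with hy
  obtain ⟨a, hapos, ha⟩ := exists_rounding (hq y)
  have hyQ : ∑ x, |(∑ i, q y i x) - y x| ≤ 2 * k := by
    have h1 : ∀ x, |(∑ i, q y i x) - y x| ≤ 2 + ((∑ i, q y i x) - y x) := by
      intro x
      have h2 := hfix x
      simp only [F, ← hy] at h2
      rw [← add_div, le_div_iff₀ hn0] at h2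
      have h3 : y x = s x * n := by rw [hy]; simp [mul_comm]
      rw [abs_le]
      constructor <;> linarith
    refine (Finset.sum_le_sum fun x _ => h1 x).trans (le_of_eq ?_)
    have h4 : ∑ x, y x = n := by
      rw [hy]; simp only [Pi.smul_apply, smul_eq_mul]
      rw [← Finset.mul_sum, hs.2, mul_one]
    rw [Finset.sum_add_distrib, Finset.sum_sub_distrib, hsumQ, h4]
    simp [mul_comm]
  have hda : d a y ≤ 4 * k + 2 := by
    have h1 : d a y ≤ ∑ x, (|(actCount n k a x : ℝ) - ∑ i, q y i x| +
        |(∑ i, q y i x) - y x|) := Finset.sum_le_sum fun x _ => abs_sub_le _ _ _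
    have h2 : ∑ x, |(actCount n k a x : ℝ) - ∑ i, q y i x| ≤ 2 * (k + 1) := by
      rw [Fintype.card_fin] at ha
      simp only [actCount]
      convert ha
    rw [Finset.sum_add_distrib] at h1
    linarith
  have hdu : ∀ i x, d (Function.update a i x) y ≤ 4 * k + 4 := by
    intro i x
    have h1 : ∀ z, |(actCount n k (Function.update a i x) z : ℝ) - y z| ≤
        |(actCount n k a z : ℝ) - y z| +
          ((if a i = z then 1 else 0) + if x = z then 1 else 0) := by
      intro z
      have h2 : (actCount n k (Function.update a i x) z : ℝ) - y z =
          (actCount n k a z - y z) + ((if x = z then 1 else 0) - if a i = z then 1 else 0) := by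
        have := congrArg (Nat.cast : ℕ → ℝ) (actCount_update a i x z)
        push_cast at this
        linarith
      rw [h2]
      refine (abs_add_le _ _).trans (add_le_add_right ?_ _)
      split_ifs <;> norm_num
    have h3 := Finset.sum_le_sum fun z (_ : z ∈ univ) => h1 z
    simp only [Finset.sum_add_distrib, Finset.sum_ite_eq, mem_univ, if_true] at h3
    have h4 : d (Function.update a i x) y ≤ d a y + (1 + 1) := h3
    linarith
  refine ⟨a, fun i x => ?_⟩
  have h1 := (abs_le.1 (hv i (Function.update a i x) y)).1
  rw [Function.update_self] at h1
  have h2 : v i x y ≤ M i y := Finset.le_sup' (fun x => v i x y) (mem_univ x)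
  have h3 : M i y < v i (a i) y + L := by
    have h4 : 0 < e i (a i) y := by
      by_contra! h
      have h5 : e i (a i) y = 0 := le_antisymm h (he0 _ _ _)
      have h6 := hapos i
      simp [q, h5] at h6
    rcases lt_max_iff.1 h4 with h | h
    · exact absurd h (lt_irrefl _)
    · linarith
  have h4 := (abs_le.1 (hv i a y)).2
  have h5 := mul_le_mul_of_nonneg_left hda hL.le
  have h6 := mul_le_mul_of_nonneg_left (hdu i x) hL.le
  linarith


theorem perturbW_nonneg {k : ℕ} {δ : ℝ} (h0 : 0 ≤ δ) (h1 : δ ≤ 1) (x y : Fin k) :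
    0 ≤ perturbW k δ x y := by
  have : 0 ≤ 1 - δ := by linarith
  unfold perturbW
  positivity

theorem div_le_perturbW {k : ℕ} {δ : ℝ} (h1 : δ ≤ 1) (x y : Fin k) :
    δ / k ≤ perturbW k δ x y := by
  have : 0 ≤ 1 - δ := by linarith
  unfold perturbW
  have : 0 ≤ (1 - δ) * (if y = x then 1 else 0) := by positivity
  linarith

theorem sum_perturbW_mul {k : ℕ} (δ : ℝ) (x : Fin k) (φ : Fin k → ℝ) :
    ∑ y, perturbW k δ x y * φ y = (1 - δ) * φ x + δ / k * ∑ y, φ y := by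
  simp only [perturbW, add_mul, Finset.sum_add_distrib, ← Finset.mul_sum, mul_assoc]
  simp

theorem sum_perturbW {k : ℕ} (δ : ℝ) (x : Fin k) : ∑ y, perturbW k δ x y = 1 := by
  have hk : (k : ℝ) ≠ 0 := by
    have := x.pos
    positivity
  have := sum_perturbW_mul δ x fun _ => 1
  simp only [mul_one, Finset.sum_const, Finset.card_univ, Fintype.card_fin, nsmul_eq_mul] at this
  rw [this]
  field_simp
  ring

/-- Two profiles with the same action counts that agree at `i` differ by a permutation of the
other players. -/
theorem exists_perm_of_actCount_eq {n k : ℕ} {a b : Fin n → Fin k} {i : Fin n} (hab : a i = b i)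
    (h : ∀ x, actCount n k a x = actCount n k b x) :
    ∃ π : Equiv.Perm (Fin n), π i = i ∧ ∀ l, a (π l) = b l := by
  have hcard : ∀ x, Nonempty ({l // b l = x} ≃ {l // a l = x}) := fun x => by
    refine Fintype.card_eq.1 ?_
    rw [Fintype.card_subtype, Fintype.card_subtype]
    exact (h x).symm
  let π₀ : Equiv.Perm (Fin n) := (Equiv.sigmaFiberEquiv b).symm.trans
    ((Equiv.sigmaCongrRight fun x => (hcard x).some).trans (Equiv.sigmaFiberEquiv a))
  have hπ₀ : ∀ l, a (π₀ l) = b l := fun l => ((hcard (b l)).some ⟨l, rfl⟩).2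
  refine ⟨π₀.trans (Equiv.swap i (π₀ i)), by simp, fun l => ?_⟩
  rw [Equiv.trans_apply, ← hπ₀ l]
  rcases eq_or_ne (π₀ l) i with h1 | h1
  · rw [h1, Equiv.swap_apply_left, hπ₀, hab]
  rcases eq_or_ne (π₀ l) (π₀ i) with h2 | h2
  · rw [h2, Equiv.swap_apply_right, hπ₀, hab]
  · rw [Equiv.swap_apply_of_ne_of_ne h1 h2]

theorem IsAnonymous.perturbGame {n k : ℕ} {g : (Fin n → Fin k) → Fin n → ℝ}
    (hg : IsAnonymous n k g) (δ : ℝ) : IsAnonymous n k (perturbGame n k δ g) := by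
  intro a b i hab h
  obtain ⟨π, hπi, hπ⟩ := exists_perm_of_actCount_eq hab h
  refine Fintype.sum_equiv (π.symm.arrowCongr (Equiv.refl _)) _ _ fun c => ?_
  have hc : π.symm.arrowCongr (Equiv.refl _) c = c ∘ π := by ext; simp
  rw [hc]
  congr 1
  · simp only [profW, ← hπ, Function.comp_apply]
    exact (Equiv.prod_comp π fun l => perturbW k δ (a l) (c l)).symm
  · refine hg _ _ _ (by simp [hπi]) fun x => ?_
    rw [actCount_eq_sum, actCount_eq_sum]
    exact (Equiv.sum_comp π fun l => if c l = x then 1 else 0).symm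

theorem perturbGame_update {n k : ℕ} (δ : ℝ) (g : (Fin n → Fin k) → Fin n → ℝ)
    (a : Fin n → Fin k) (i j : Fin n) (x : Fin k) :
    perturbGame n k δ g (Function.update a j x) i =
      (1 - δ) * prodExp (fun l => perturbW k δ (a l)) (fun b => g (Function.update b j x) i) +
      δ / k * ∑ y, prodExp (fun l => perturbW k δ (a l)) fun b => g (Function.update b j y) i := by
  have h := prodExp_update (fun l => perturbW k δ (a l)) (fun b => g b i) j (perturbW k δ x)
    (sum_perturbW δ _)
  rw [sum_perturbW_mul δ x fun y =>
    prodExp (fun l => perturbW k δ (a l)) fun b => g (Function.update b j y) i] at h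
  rw [← h]
  change prodExp _ _ = _
  congr 1
  ext l
  rcases eq_or_ne l j with rfl | hl
  · simp
  · simp [hl]

/-- The payoffs of a perturbed anonymous game change little when an opponent switches actions. -/
theorem abs_perturbGame_update_sub_le {n k : ℕ} (hn : 3 ≤ n) {δ : ℝ} (h0 : 0 < δ) (h1 : δ ≤ 1)
    {g : (Fin n → Fin k) → Fin n → ℝ} (hgame : IsGame n k g) (hg : IsAnonymous n k g)
    (a : Fin n → Fin k) (i j : Fin n) (p : Fin k) (hji : j ≠ i) :
    |perturbGame n k δ g (Function.update a j p) i - perturbGame n k δ g a i| ≤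
      2 * √(1 / (δ / k * (n - 2))) := by
  have hk : (0 : ℝ) < k := by exact_mod_cast p.pos
  have hcard : (univ \ {i, j} : Finset (Fin n)).card = n - 2 := by
    rw [Finset.card_sdiff_of_subset (Finset.subset_univ _), Finset.card_pair hji.symm,
      Finset.card_univ, Fintype.card_fin]
  have hcard' : ((univ \ {i, j} : Finset (Fin n)).card : ℝ) = n - 2 := by
    rw [hcard, Nat.cast_sub (by omega)]
    norm_num
  have habs : ∀ b, |g b i| ≤ 1 := fun b => abs_le.2 ⟨by linarith [(hgame b i).1], (hgame b i).2⟩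
  have key := abs_prodExp_sub_le (w := fun l => perturbW k δ (a l))
    (fun l y => perturbW_nonneg h0.le h1 (a l) y) (fun l => sum_perturbW δ (a l))
    (S := univ \ {i, j}) (Finset.card_pos.1 (by omega)) (div_pos h0 hk) (x := p) (y := a j)
    (fun l _ => div_le_perturbW h1 _ _) (fun l _ => div_le_perturbW h1 _ _)
    (G := fun b => g (Function.update b j p) i) (H := fun b => g (Function.update b j (a j)) i)
    (fun b => habs _) (fun b => habs _) (fun b l hl => by
      simp only [mem_sdiff, mem_univ, mem_insert, mem_singleton, true_and, not_or] at hl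
      refine hg _ _ _ ?_ fun x => ?_
      · rw [Function.update_of_ne hji.symm, Function.update_of_ne hji.symm,
          Function.update_of_ne (Ne.symm hl.1), Function.update_of_ne (Ne.symm hl.1)]
      · have e1 := actCount_update (Function.update b l (a j)) j p x
        have e2 := actCount_update (Function.update b l p) j (a j) x
        have e3 := actCount_update b l (a j) x
        have e4 := actCount_update b l p x
        rw [Function.update_of_ne (Ne.symm hl.2)] at e1 e2
        omega)
  rw [hcard'] at key
  have hself := perturbGame_update δ g a i j (a j)
  rw [Function.update_eq_self] at hself
  rw [perturbGame_update, hself, add_sub_add_right_eq_sub, ← mul_sub, abs_mul,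
    abs_of_nonneg (by linarith : 0 ≤ 1 - δ)]
  exact (mul_le_of_le_one_left (abs_nonneg _) (by linarith)).trans key

/-- A pure approximate equilibrium of the perturbed game is a perturbed-pure approximate
equilibrium of the original game. -/
theorem isEpsNash_perturbW {n k : ℕ} {δ ρ : ℝ} (h0 : 0 ≤ δ) (h1 : δ ≤ 1)
    {g : (Fin n → Fin k) → Fin n → ℝ} (hgame : IsGame n k g) {a : Fin n → Fin k}
    (ha : ∀ i x, perturbGame n k δ g (Function.update a i x) i ≤ perturbGame n k δ g a i + ρ) :
    IsEpsNash n k (ρ + δ) g fun i => perturbW k δ (a i) := by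
  intro i τ hτ
  set U : Fin k → ℝ := fun x =>
    prodExp (fun l => perturbW k δ (a l)) fun b => g (Function.update b i x) i with hU
  have hUmem : ∀ x, U x ∈ Set.Icc (0 : ℝ) 1 := fun x =>
    prodExp_mem_Icc (fun l y => perturbW_nonneg h0 h1 (a l) y) (fun l => sum_perturbW δ (a l))
      fun b => hgame _ i
  have hdev : expPay n k g (Function.update (fun l => perturbW k δ (a l)) i τ) i =
      ∑ x, τ x * U x :=
    prodExp_update (fun l => perturbW k δ (a l)) (fun b => g b i) i τ (sum_perturbW δ _)
  have hbound : ∀ x, U x ≤ perturbGame n k δ g a i + (ρ + δ) := by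
    intro x
    have e1 := ha i x
    rw [perturbGame_update] at e1
    change (1 - δ) * U x + δ / k * ∑ y, U y ≤ _ at e1
    have e2 : 0 ≤ δ / k * ∑ y, U y :=
      mul_nonneg (by positivity) (Finset.sum_nonneg fun y _ => (hUmem y).1)
    have e3 : δ * U x ≤ δ := mul_le_of_le_one_right h0 (hUmem x).2
    linarith
  have hsum : ∑ x, τ x * U x ≤ ∑ x, τ x * (perturbGame n k δ g a i + (ρ + δ)) :=
    Finset.sum_le_sum fun x _ => mul_le_mul_of_nonneg_left (hbound x) (hτ.1 x)
  rw [← Finset.sum_mul, hτ.2, one_mul] at hsum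
  have hself : expPay n k g (fun l => perturbW k δ (a l)) i = perturbGame n k δ g a i := rfl
  rw [hdev, hself]
  linarith

theorem isEpsNash_one {n k : ℕ} {g : (Fin n → Fin k) → Fin n → ℝ} (hgame : IsGame n k g)
    {σ : Fin n → Fin k → ℝ} (hσ : ∀ i, IsMixed k (σ i)) : IsEpsNash n k 1 g σ := by
  intro i τ hτ
  have hupd : ∀ l, IsMixed k (Function.update σ i τ l) := by
    intro l
    rcases eq_or_ne l i with rfl | hl
    · simpa using hτ
    · simpa [hl] using hσ l
  have e1 : expPay n k g (Function.update σ i τ) i ∈ Set.Icc (0 : ℝ) 1 :=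
    prodExp_mem_Icc (fun l => (hupd l).1) (fun l => (hupd l).2) fun b => hgame b i
  have e2 : expPay n k g σ i ∈ Set.Icc (0 : ℝ) 1 :=
    prodExp_mem_Icc (fun l => (hσ l).1) (fun l => (hσ l).2) fun b => hgame b i
  linarith [e1.2, e2.1]

/-- There are `ε(n,k), δ(n,k) = O(k·n^{-1/3})` such that every `n`-player `k`-action
anonymous game admits an `ε(n,k)`-Nash equilibrium in `δ(n,k)`-perturbed pure
strategies. -/
theorem exists_perturbed_pure_epsNash_rate :
    ∃ C : ℝ, 0 < C ∧ ∀ n k : ℕ, 1 ≤ n → 2 ≤ k →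
      ∃ ε δ : ℝ, 0 < δ ∧ δ < 1 ∧
        ε ≤ C * k * (n : ℝ) ^ (-(1 / 3) : ℝ) ∧ δ ≤ C * k * (n : ℝ) ^ (-(1 / 3) : ℝ) ∧
        ∀ g : (Fin n → Fin k) → Fin n → ℝ, IsGame n k g → IsAnonymous n k g →
          ∃ a : Fin n → Fin k, IsEpsNash n k ε g (fun i => perturbW k δ (a i)) := by
  refine ⟨37, by norm_num, fun n k hn hk => ?_⟩
  have hn0 : (0 : ℝ) < n := by exact_mod_cast hn
  have hk2 : (2 : ℝ) ≤ k := by exact_mod_cast hk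
  set s : ℝ := (n : ℝ) ^ (1 / 3 : ℝ) with hs
  have hs0 : 0 < s := Real.rpow_pos_of_pos hn0 _
  have hs3 : s ^ 3 = n := by
    rw [hs, ← Real.rpow_natCast, ← Real.rpow_mul hn0.le]
    norm_num
  have hrate : (37 : ℝ) * k * (n : ℝ) ^ (-(1 / 3) : ℝ) = 37 * (k / s) := by
    rw [Real.rpow_neg hn0.le, ← hs]
    ring
  rw [hrate]
  have hθ0 : 0 < k / s := by positivity
  rcases le_or_gt (1 / 2) (k / s) with hθ | hθ
  · refine ⟨1, 1 / 2, by norm_num, by norm_num, by linarith, by linarith, fun g hgame _ => ?_⟩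
    exact ⟨fun _ => ⟨0, by omega⟩, isEpsNash_one hgame fun i =>
      ⟨fun y => perturbW_nonneg (by norm_num) (by norm_num) _ y, sum_perturbW _ _⟩⟩
  have hsk : 2 * k < s := by
    rw [div_lt_iff₀ hs0] at hθ
    linarith
  have hs4 : 4 < s := by linarith
  have hnlarge : (64 : ℝ) < n := by
    rw [← hs3]
    calc (64 : ℝ) = 4 ^ 3 := by norm_num
      _ < s ^ 3 := by gcongr
  have hn3 : 3 ≤ n := by
    have : (3 : ℝ) < n := by linarith
    exact_mod_cast this.le
  refine ⟨37 * (k / s), k / s, hθ0, by linarith, le_rfl, by linarith, fun g hgame hg => ?_⟩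
  have hL : 2 * √(1 / (k / s / k * (n - 2))) ≤ 3 / s := by
    have e1 : k / s / k * ((n : ℝ) - 2) = (s ^ 3 - 2) / s := by
      rw [hs3]
      field_simp
    have e2 : √(1 / (k / s / k * ((n : ℝ) - 2))) ≤ 3 / (2 * s) := by
      refine Real.sqrt_le_iff.2 ⟨by positivity, ?_⟩
      rw [e1, one_div_div, div_pow, div_le_div_iff₀ (by linarith) (by positivity)]
      nlinarith
    calc 2 * √(1 / (k / s / k * ((n : ℝ) - 2))) ≤ 2 * (3 / (2 * s)) := by gcongr
      _ = 3 / s := by field_simp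
  obtain ⟨a, ha⟩ := exists_pure_approx_nash hn hk (hg.perturbGame (k / s)) (L := 3 / s)
    (by positivity) fun a i j p hji =>
      (abs_perturbGame_update_sub_le hn3 hθ0 (by linarith) hgame hg a i j p hji).trans hL
  refine ⟨a, ?_⟩
  have hregret : 3 / s * (8 * k + 7) ≤ 36 * (k / s) := by
    rw [div_mul_eq_mul_div, mul_div_assoc', div_le_div_iff_of_pos_right hs0]
    linarith
  have hnash := isEpsNash_perturbW hθ0.le (by linarith) hgame (ρ := 36 * (k / s))
    fun i x => (ha i x).trans (by linarith)
  convert hnash using 1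
  ring
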